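/- Let a state of PIF satisfy RP(k) for some 1 ≤ k ≤ N−1. Then exactly one action is enabled: if k ≥ 2 it is back at process p_k, and its execution yields a state satisfying RP(k−1); if k = 1 it is clear, and its execution yields the state satisfying RQ(0,1). -/

import Mathlib

/-- Values of the state variable of a PIF process: idle, requesting, replying. -/
inductive PSt where
  | idle | rq | rp
deriving DecidableEq

/-- A PIF state on the chain of `N` processes is valid if the root (process 1)
never holds `rp` and the leaf (process `N`) never holds `rq`. -/
def PifValid (N : ℕ) (st : ℕ → PSt) : Prop := st 1 ≠ PSt.rp ∧ st N ≠ PSt.rq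

/-- One step of the PIF program on the chain of `N` processes: `st'` is
obtained from `st` by executing one enabled action (request, clear, forward,
back, stop, reflect or reset). -/
def pifStep (N : ℕ) (st st' : ℕ → PSt) : Prop :=
  -- request (root)
  (st 1 = PSt.idle ∧ st 2 = PSt.idle ∧ st' = Function.update st 1 PSt.rq) ∨
  -- clear (root)
  (st 1 = PSt.rq ∧ st 2 = PSt.rp ∧ st' = Function.update st 1 PSt.idle) ∨
  -- forward (intermediate)
  (∃ j, 2 ≤ j ∧ j ≤ N - 1 ∧ st (j - 1) = PSt.rq ∧ st j = PSt.idle ∧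
    st (j + 1) = PSt.idle ∧ st' = Function.update st j PSt.rq) ∨
  -- back (intermediate)
  (∃ j, 2 ≤ j ∧ j ≤ N - 1 ∧ st (j - 1) = PSt.rq ∧ st j = PSt.rq ∧
    st (j + 1) = PSt.rp ∧ st' = Function.update st j PSt.rp) ∨
  -- stop (intermediate)
  (∃ j, 2 ≤ j ∧ j ≤ N - 1 ∧ st (j - 1) = PSt.idle ∧ st j ≠ PSt.idle ∧
    st' = Function.update st j PSt.idle) ∨
  -- reflect (leaf)
  (st (N - 1) = PSt.rq ∧ st N = PSt.idle ∧ st' = Function.update st N PSt.rp) ∨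
  -- reset (leaf)
  (st (N - 1) = PSt.idle ∧ st N = PSt.rp ∧ st' = Function.update st N PSt.idle)

/-- `RP N k st`: the `k` leftmost processes are requesting and the rest are
replying (`1 ≤ k ≤ N - 1`). -/
def RP (N k : ℕ) (st : ℕ → PSt) : Prop :=
  1 ≤ k ∧ k ≤ N - 1 ∧
  (∀ j, 1 ≤ j → j ≤ k → st j = PSt.rq) ∧
  (∀ j, k < j → j ≤ N → st j = PSt.rp)

/-- `RQ N l m st`: the `l` leftmost processes are requesting, processes
`l+1 .. m` are idle, and the rest are replying (`0 ≤ l < m ≤ N`). -/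
def RQ (N l m : ℕ) (st : ℕ → PSt) : Prop :=
  l < m ∧ m ≤ N ∧
  (∀ j, 1 ≤ j → j ≤ l → st j = PSt.rq) ∧
  (∀ j, l < j → j ≤ m → st j = PSt.idle) ∧
  (∀ j, m < j → j ≤ N → st j = PSt.rp)

/-- `RP' N k st`: the `k` leftmost processes are requesting, process `k+1` is
replying, and no process beyond `k+1` is idle (`1 ≤ k ≤ N - 1`). -/
def RP' (N k : ℕ) (st : ℕ → PSt) : Prop :=
  1 ≤ k ∧ k ≤ N - 1 ∧
  (∀ j, 1 ≤ j → j ≤ k → st j = PSt.rq) ∧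
  st (k + 1) = PSt.rp ∧
  (∀ j, k + 1 < j → j ≤ N → st j ≠ PSt.idle)

/-- `RQ' N l m st`: the `l` leftmost processes are requesting, processes
`l+1 .. m` are idle, and the remaining processes are arbitrary
(`0 ≤ l < m ≤ N`). -/
def RQ' (N l m : ℕ) (st : ℕ → PSt) : Prop :=
  l < m ∧ m ≤ N ∧
  (∀ j, 1 ≤ j → j ≤ l → st j = PSt.rq) ∧
  (∀ j, l < j → j ≤ m → st j = PSt.idle)

/-- From a state satisfying `RP k` (`1 ≤ k ≤ N-1`) exactly one action is
enabled: if `k ≥ 2` it is `back` at process `k` and its execution yields a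
state satisfying `RP (k-1)`; if `k = 1` it is `clear` and its execution yields
the state satisfying `RQ 0 1`. -/
theorem pif_rp_progress (N : ℕ) (hN : 3 ≤ N)
    (st : ℕ → PSt) (hv : PifValid N st)
    (k : ℕ) (h : RP N k st) :
    (∃! st', pifStep N st st') ∧
    (2 ≤ k →
      ∀ st', pifStep N st st' →
        st' = Function.update st k PSt.rp ∧ RP N (k - 1) st') ∧
    (k = 1 →
      ∀ st', pifStep N st st' →
        st' = Function.update st 1 PSt.idle ∧ RQ N 0 1 st') := by
  obtain ⟨h1, h2, hq, hp⟩ := h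
  have noidle : ∀ j, 1 ≤ j → j ≤ N → st j ≠ PSt.idle := by
    intro j a b
    by_cases c : j ≤ k
    · rw [hq j a c]; exact PSt.noConfusion
    · rw [hp j (by omega) b]; exact PSt.noConfusion
  have rqle : ∀ j, j ≤ N → st j = PSt.rq → j ≤ k := by
    intro j b e
    by_contra c
    rw [hp j (by omega) b] at e
    exact PSt.noConfusion e
  have rplt : ∀ j, 1 ≤ j → st j = PSt.rp → k < j := by
    intro j b e
    by_contra c
    rw [hq j b (by omega)] at e
    exact PSt.noConfusion e
  have key : ∀ st', pifStep N st st' →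
      (k = 1 ∧ st' = Function.update st 1 PSt.idle) ∨
      (2 ≤ k ∧ st' = Function.update st k PSt.rp) := by
    intro st' hs
    rcases hs with ⟨a, _, _⟩ | ⟨_, b, c⟩ | ⟨j, a, b, _, c, _⟩ | ⟨j, a, b, _, c, d, e⟩ |
      ⟨j, a, b, c, _⟩ | ⟨_, a, _⟩ | ⟨a, _⟩
    · exact absurd a (noidle 1 (by omega) (by omega))
    · have := rplt 2 (by omega) b
      exact Or.inl ⟨by omega, c⟩
    · exact absurd c (noidle j (by omega) (by omega))
    · have x := rqle j (by omega) c
      have y := rplt (j + 1) (by omega) d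
      obtain rfl : j = k := by omega
      exact Or.inr ⟨a, e⟩
    · exact absurd c (noidle (j - 1) (by omega) (by omega))
    · exact absurd a (noidle N (by omega) (by omega))
    · exact absurd a (noidle (N - 1) (by omega) (by omega))
  refine ⟨?_, ?_, ?_⟩
  · by_cases hk : k = 1
    · refine ⟨Function.update st 1 PSt.idle, ?_, ?_⟩
      · exact Or.inr (Or.inl ⟨hq 1 (by omega) (by omega), hp 2 (by omega) (by omega), rfl⟩)
      · intro y hy
        rcases key y hy with ⟨_, e⟩ | ⟨a, _⟩
        · exact e
        · omega
    · refine ⟨Function.update st k PSt.rp, ?_, ?_⟩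
      · exact Or.inr (Or.inr (Or.inr (Or.inl ⟨k, by omega, h2, hq _ (by omega) (by omega),
          hq _ (by omega) (by omega), hp _ (by omega) (by omega), rfl⟩)))
      · intro y hy
        rcases key y hy with ⟨a, _⟩ | ⟨_, e⟩
        · omega
        · exact e
  · intro hk st' hs
    rcases key st' hs with ⟨a, _⟩ | ⟨_, e⟩
    · omega
    · refine ⟨e, by omega, by omega, ?_, ?_⟩
      · intro j a b
        rw [e, Function.update_of_ne (by omega)]
        exact hq j a (by omega)
      · intro j a b
        by_cases c : j = k
        · rw [e, c, Function.update_self]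
        · rw [e, Function.update_of_ne c]
          exact hp j (by omega) b
  · intro hk st' hs
    rcases key st' hs with ⟨_, e⟩ | ⟨a, _⟩
    · refine ⟨e, by omega, by omega, ?_, ?_, ?_⟩
      · intro j a b
        omega
      · intro j a b
        obtain rfl : j = 1 := by omega
        rw [e, Function.update_self]
      · intro j a b
        rw [e, Function.update_of_ne (by omega)]
        exact hp j (by omega) b
    · omega
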